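/- arXiv:1508.04690 — 4 statements merged into one kernel-verified Lean document; each statement's English description precedes it below -/
import Mathlib

section
/- Let Z : ℂ^L → ℂ be symmetric, and fix indices 1 ≤ p < q ≤ L. Then the left-hand side F(λ_0, λ_1, …, λ_L) := Σ_{i=0}^L M_i · Z(λ_0,…,λ̂_i,…,λ_L) of (FZ) is invariant under interchanging λ_p and λ_q: at every point where all coefficients M_i are defined, F(λ_0,…,λ_p,…,λ_q,…,λ_L) = F(λ_0,…,λ_q,…,λ_p,…,λ_L). In particular, the coefficients satisfy M_p|_{λ_p ↔ λ_q} = M_q, M_q|_{λ_p ↔ λ_q} = M_p, and M_i|_{λ_p ↔ λ_q} = M_i for i ∉ {p,q}. -/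
open Finset Function

noncomputable section

/-- Rational six-vertex weights: `a x = x + η`, `b x = x`, `c x = η`.
The coefficient `M₀` of the functional equation (FZ). -/
def Mzero {L : ℕ} (η : ℂ) (μ : Fin L → ℂ) (lam0 : ℂ) (lam : Fin L → ℂ) : ℂ :=
  ∏ j, (lam0 - μ j) -
    (∏ j, (lam0 - μ j + η)) * ∏ j, (lam j - lam0 + η) / (lam j - lam0)

/-- The coefficient `M_i`, `1 ≤ i ≤ L`, of the functional equation (FZ). -/
def Mcoef {L : ℕ} (η : ℂ) (μ : Fin L → ℂ) (lam0 : ℂ) (lam : Fin L → ℂ) (i : Fin L) : ℂ :=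
  η / (lam i - lam0) * (∏ j, (lam i - μ j + η)) *
    ∏ j ∈ univ.erase i, (lam j - lam i + η) / (lam j - lam i)

/-- The left-hand side `F(λ₀, λ₁, …, λ_L)` of the functional equation (FZ). -/
def Flhs {L : ℕ} (Z : (Fin L → ℂ) → ℂ) (η : ℂ) (μ : Fin L → ℂ)
    (lam0 : ℂ) (lam : Fin L → ℂ) : ℂ :=
  Mzero η μ lam0 lam * Z lam +
    ∑ i, Mcoef η μ lam0 lam i * Z (Function.update lam i lam0)

/-- `Z` is a symmetric function of its `L` arguments. -/
def SymmFun {L : ℕ} (Z : (Fin L → ℂ) → ℂ) : Prop :=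
  ∀ σ : Equiv.Perm (Fin L), ∀ lam : Fin L → ℂ, Z (lam ∘ σ) = Z lam

theorem Mzero_comp_perm {L : ℕ} (η : ℂ) (μ : Fin L → ℂ) (lam0 : ℂ) (lam : Fin L → ℂ)
    (σ : Equiv.Perm (Fin L)) : Mzero η μ lam0 (lam ∘ σ) = Mzero η μ lam0 lam := by
  simp only [Mzero, Function.comp_apply]
  rw [Equiv.prod_comp σ fun j => (lam j - lam0 + η) / (lam j - lam0)]

theorem Mcoef_comp_perm {L : ℕ} (η : ℂ) (μ : Fin L → ℂ) (lam0 : ℂ) (lam : Fin L → ℂ)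
    (σ : Equiv.Perm (Fin L)) (i : Fin L) :
    Mcoef η μ lam0 (lam ∘ σ) i = Mcoef η μ lam0 lam (σ i) := by
  simp only [Mcoef, Function.comp_apply]
  congr 1
  exact Finset.prod_equiv σ (by simp) (by simp)

theorem Flhs_comp_perm {L : ℕ} {Z : (Fin L → ℂ) → ℂ} (hZ : SymmFun Z) (η : ℂ)
    (μ : Fin L → ℂ) (lam0 : ℂ) (lam : Fin L → ℂ) (σ : Equiv.Perm (Fin L)) :
    Flhs Z η μ lam0 (lam ∘ σ) = Flhs Z η μ lam0 lam := by
  have hupd (i : Fin L) :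
      Z (Function.update (lam ∘ σ) i lam0) = Z (Function.update lam (σ i) lam0) := by
    rw [← hZ σ (Function.update lam (σ i) lam0), Function.update_comp_eq_of_injective _ σ.injective]
  simp only [Flhs, Mzero_comp_perm, Mcoef_comp_perm, hZ σ lam, hupd]
  rw [Equiv.sum_comp σ fun i => Mcoef η μ lam0 lam i * Z (Function.update lam i lam0)]

/-- for symmetric `Z` and indices `p ≠ q` in `{1,…,L}`, the left-hand side of
(FZ) is invariant under the interchange `λ_p ↔ λ_q` at every point where all the coefficients
`M_i` are defined; in particular `M_p|_{λ_p↔λ_q} = M_q`, `M_q|_{λ_p↔λ_q} = M_p` and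
`M_i|_{λ_p↔λ_q} = M_i` for `i ∉ {p, q}`. -/
theorem Flhs_swap_invariant {L : ℕ} (hL : 2 ≤ L) (η : ℂ) (hη : η ≠ 0) (μ : Fin L → ℂ)
    (Z : (Fin L → ℂ) → ℂ) (hZ : SymmFun Z) (p q : Fin L) (hpq : p ≠ q)
    (lam0 : ℂ) (lam : Fin L → ℂ)
    (hdef0 : ∀ j : Fin L, lam j ≠ lam0)
    (hdef : ∀ j k : Fin L, j ≠ k → lam j ≠ lam k) :
    Flhs Z η μ lam0 (lam ∘ Equiv.swap p q) = Flhs Z η μ lam0 lam ∧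
    Mcoef η μ lam0 (lam ∘ Equiv.swap p q) p = Mcoef η μ lam0 lam q ∧
    Mcoef η μ lam0 (lam ∘ Equiv.swap p q) q = Mcoef η μ lam0 lam p ∧
    ∀ i : Fin L, i ≠ p → i ≠ q →
      Mcoef η μ lam0 (lam ∘ Equiv.swap p q) i = Mcoef η μ lam0 lam i := by
  refine ⟨Flhs_comp_perm hZ η μ lam0 lam _, ?_, ?_, fun i hip hiq => ?_⟩
  · rw [Mcoef_comp_perm, Equiv.swap_apply_left]
  · rw [Mcoef_comp_perm, Equiv.swap_apply_right]
  · rw [Mcoef_comp_perm, Equiv.swap_apply_of_ne_of_ne hip hiq]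
end
end

section
/- (Theorem 1, Knizhnik–Zamolodchikov-type PDE.) Let Z : ℂ^L → ℂ be symmetric and holomorphic, and suppose that for every generic point λ = (λ_1,…,λ_L) ∈ ℂ^L the functional equation (FZ) holds at (λ_0, λ_1, …, λ_L) for all λ_0 in a punctured neighborhood of λ_i avoiding the points where the coefficients M_j are undefined. Then for each i ∈ {1,…,L} and every generic λ, η · ∂Z/∂λ_i (λ) = Σ_{j=1, j≠i}^L ω_{ij}(λ) · Z(λ_1,…,λ_{j−1}, λ_i, λ_{j+1},…,λ_L) + h_i(λ) · Z(λ), i.e. in the j-th term the argument λ_j is replaced by λ_i, where ω_{ij} := (η/a(λ_j − λ_i)) · (a(λ_i − λ_j)/b(λ_i − λ_j)) · ∏_{k=1}^L a(λ_j − μ_k)/a(λ_i − μ_k) · ∏_{k≠i,j} (b(λ_k − λ_i)/a(λ_k − λ_i)) · (a(λ_k − λ_j)/b(λ_k − λ_j)), and h_i := ∏_{k=1}^L b(λ_i − μ_k)/a(λ_i − μ_k) · ∏_{k≠i} b(λ_k − λ_i)/a(λ_k − λ_i) + Σ_{k=1}^L η/a(λ_i − μ_k) + Σ_{k≠i} η^2/(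 b(λ_k − λ_i) · a(λ_k − λ_i) ) − 1. -/
open Finset Function Topology

noncomputable section

/-- The functional equation (FZ) at the point `(λ₀, λ₁, …, λ_L)`. -/
def FZ {L : ℕ} (Z : (Fin L → ℂ) → ℂ) (η : ℂ) (μ : Fin L → ℂ)
    (lam0 : ℂ) (lam : Fin L → ℂ) : Prop :=
  Mzero η μ lam0 lam * Z lam +
    ∑ i, Mcoef η μ lam0 lam i * Z (Function.update lam i lam0) = 0

/-- A point `λ ∈ ℂ^L` is generic: the `λ_j` are pairwise distinct, `λ_j - λ_k + η ≠ 0`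
for `j ≠ k`, and `λ_j - μ_k + η ≠ 0` for all `j, k`. -/
def Generic {L : ℕ} (η : ℂ) (μ lam : Fin L → ℂ) : Prop :=
  (∀ j k : Fin L, j ≠ k → lam j ≠ lam k) ∧
  (∀ j k : Fin L, j ≠ k → lam j - lam k + η ≠ 0) ∧
  (∀ j k : Fin L, lam j - μ k + η ≠ 0)

/-- The coefficient `ω_{ij}` of the Knizhnik–Zamolodchikov-type equation (KZE). -/
def omegaKZE {L : ℕ} (η : ℂ) (μ lam : Fin L → ℂ) (i j : Fin L) : ℂ :=
  η / (lam j - lam i + η) * ((lam i - lam j + η) / (lam i - lam j)) *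
    (∏ k, (lam j - μ k + η) / (lam i - μ k + η)) *
    ∏ k ∈ univ \ {i, j},
      (lam k - lam i) / (lam k - lam i + η) * ((lam k - lam j + η) / (lam k - lam j))

/-- The coefficient `h_i` of the Knizhnik–Zamolodchikov-type equation (KZE). -/
def hKZE {L : ℕ} (η : ℂ) (μ lam : Fin L → ℂ) (i : Fin L) : ℂ :=
  (∏ k, (lam i - μ k) / (lam i - μ k + η)) *
      ∏ k ∈ univ.erase i, (lam k - lam i) / (lam k - lam i + η) +
    ∑ k, η / (lam i - μ k + η) +
    ∑ k ∈ univ.erase i, η ^ 2 / ((lam k - lam i) * (lam k - lam i + η)) - 1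

/-- Logarithmic form of the derivative of a finite product of nonvanishing functions. -/
theorem hasDerivAt_finset_prod_log {ι : Type*} (s : Finset ι) {f : ι → ℂ → ℂ} {f' : ι → ℂ}
    {x : ℂ} (hf : ∀ k ∈ s, HasDerivAt (f k) (f' k) x) (h0 : ∀ k ∈ s, f k x ≠ 0) :
    HasDerivAt (fun y => ∏ k ∈ s, f k y) ((∏ k ∈ s, f k x) * ∑ k ∈ s, f' k / f k x) x := by
  classical
  induction s using Finset.induction_on with
  | empty => simpa using hasDerivAt_const x (1 : ℂ)
  | insert a s ha ih =>
    have h1 := (hf a (mem_insert_self a s)).mul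
      (ih (fun k hk => hf k (mem_insert_of_mem hk)) fun k hk => h0 k (mem_insert_of_mem hk))
    have ha0 := h0 a (mem_insert_self a s)
    simp only [prod_insert ha, sum_insert ha]
    refine h1.congr_deriv ?_
    field_simp

/-- Dividing `M_j` at `λ₀ = λ_i` by `∏_k a(λ_i - μ_k) ∏_{k ≠ i} a(λ_k - λ_i) / b(λ_k - λ_i)`
gives `ω_{ij}`. -/
theorem Mcoef_eq_mul_omegaKZE {L : ℕ} {η : ℂ} {μ lam : Fin L → ℂ} (hg : Generic η μ lam)
    {i j : Fin L} (hij : j ≠ i) :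
    Mcoef η μ (lam i) lam j =
      ((∏ k, (lam i - μ k + η)) * ∏ k ∈ univ.erase i, (lam k - lam i + η) / (lam k - lam i)) *
        omegaKZE η μ lam i j := by
  obtain ⟨h1, h2, h3⟩ := hg
  have hA : ∏ k, (lam i - μ k + η) ≠ 0 := prod_ne_zero_iff.2 fun k _ => h3 i k
  have hset : (univ : Finset (Fin L)) \ {i, j} = (univ.erase i).erase j := by
    ext k; simp [and_comm]
  have hset' : (univ.erase j).erase i = (univ.erase i).erase j := erase_right_comm
  have hb : lam j - lam i ≠ 0 := sub_ne_zero.2 (h1 j i hij)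
  have ha : lam j - lam i + η ≠ 0 := h2 j i hij
  unfold Mcoef omegaKZE
  rw [← mul_prod_erase (univ.erase i) _ (mem_erase.2 ⟨hij, mem_univ j⟩),
    ← mul_prod_erase (univ.erase j) _ (mem_erase.2 ⟨hij.symm, mem_univ i⟩), hset, hset',
    prod_mul_distrib, prod_div_distrib (f := fun k => lam j - μ k + η)]
  have hP : (∏ k ∈ (univ.erase i).erase j, (lam k - lam i + η) / (lam k - lam i)) *
      ∏ k ∈ (univ.erase i).erase j, (lam k - lam i) / (lam k - lam i + η) = 1 := by
    rw [← prod_mul_distrib]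
    refine prod_eq_one fun k hk => ?_
    have hk : k ≠ i := (mem_erase.1 (mem_erase.1 hk).2).1
    have := sub_ne_zero.2 (h1 k i hk)
    have := h2 k i hk
    field_simp
  generalize (∏ k ∈ (univ.erase i).erase j, (lam k - lam i + η) / (lam k - lam i)) = p at *
  generalize (∏ k ∈ (univ.erase i).erase j, (lam k - lam i) / (lam k - lam i + η)) = q at *
  generalize (∏ k ∈ (univ.erase i).erase j, (lam k - lam j + η) / (lam k - lam j)) = r
  generalize (∏ k, (lam i - μ k + η)) = A at *
  generalize (∏ k, (lam j - μ k + η)) = B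
  generalize (lam i - lam j + η) / (lam i - lam j) = t
  trans (η / (lam j - lam i) * B * (t * r)) * (p * q)
  · rw [hP, mul_one]
  · field_simp

/-- Theorem 1: if the symmetric holomorphic function `Z` satisfies (FZ) for all
`λ₀` in a punctured neighborhood of `λ_i` (avoiding the points where the coefficients are
undefined) at every generic `λ`, then it satisfies the Knizhnik–Zamolodchikov-type system
`η ∂_i Z = Σ_{j≠i} ω_{ij} Z(λ with λ_j ↦ λ_i) + h_i Z(λ)` at every generic `λ`. -/
theorem KZE_of_FZ {L : ℕ} (hL : 2 ≤ L) (η : ℂ) (hη : η ≠ 0) (μ : Fin L → ℂ)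
    (Z : (Fin L → ℂ) → ℂ) (hZsymm : SymmFun Z) (hZhol : Differentiable ℂ Z)
    (hFZ : ∀ lam : Fin L → ℂ, Generic η μ lam → ∀ i : Fin L,
      ∀ᶠ lam0 in 𝓝[≠] (lam i), FZ Z η μ lam0 lam) :
    ∀ lam : Fin L → ℂ, Generic η μ lam → ∀ i : Fin L,
      η * fderiv ℂ Z lam (Pi.single i 1) =
        ∑ j ∈ univ.erase i, omegaKZE η μ lam i j * Z (Function.update lam j (lam i)) +
          hKZE η μ lam i * Z lam := by
  intro lam hg i
  have ⟨h1, h2, h3⟩ := hg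
  set x₀ := lam i with hx₀
  set A : ℂ → ℂ := fun x => ∏ k, (x - μ k + η) with hAdef
  set P : ℂ → ℂ := fun x => ∏ k ∈ univ.erase i, (lam k - x + η) / (lam k - x) with hPdef
  set B : ℂ → ℂ := fun x => ∏ k, (x - μ k) with hBdef
  have hb : ∀ k ∈ univ.erase i, lam k - x₀ ≠ 0 := fun k hk =>
    sub_ne_zero.2 (h1 k i (mem_erase.1 hk).1)
  have ha : ∀ k ∈ univ.erase i, lam k - x₀ + η ≠ 0 := fun k hk => h2 k i (mem_erase.1 hk).1
  have hA0 : A x₀ ≠ 0 := prod_ne_zero_iff.2 fun k _ => h3 i k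
  have hP0 : P x₀ ≠ 0 := prod_ne_zero_iff.2 fun k hk => div_ne_zero (ha k hk) (hb k hk)
  have hA : HasDerivAt A (A x₀ * ∑ k, 1 / (x₀ - μ k + η)) x₀ :=
    hasDerivAt_finset_prod_log univ
      (fun k _ => ((hasDerivAt_id x₀).sub_const (μ k)).add_const η) fun k _ => h3 i k
  have hP : HasDerivAt P
      (P x₀ * ∑ k ∈ univ.erase i, η / ((lam k - x₀) * (lam k - x₀ + η))) x₀ := by
    have h := hasDerivAt_finset_prod_log (univ.erase i)
      (f := fun k x => (lam k - x + η) / (lam k - x))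
      (fun k hk => (((hasDerivAt_id x₀).const_sub (lam k)).add_const η).div
        ((hasDerivAt_id x₀).const_sub (lam k)) (hb k hk))
      fun k hk => div_ne_zero (ha k hk) (hb k hk)
    refine h.congr_deriv (congrArg _ (sum_congr rfl fun k hk => ?_))
    have := hb k hk
    have := ha k hk
    simp only [id]
    field_simp
    ring
  have hF : HasDerivAt (fun x => Z (update lam i x)) (fderiv ℂ Z lam (Pi.single i 1)) x₀ := by
    have hz : HasFDerivAt Z (fderiv ℂ Z lam) (update lam i x₀) := by
      rw [hx₀, update_eq_self]
      exact (hZhol lam).hasFDerivAt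
    exact hz.comp_hasDerivAt x₀ (hasDerivAt_update lam i x₀)
  have hslope := ((((hA.mul hP).mul_const (Z lam)).sub
    (hF.const_mul (A x₀ * P x₀)))).tendsto_slope
  have hBA : Filter.Tendsto (fun x => (B x - A x * P x) * Z lam) (𝓝[≠] x₀)
      (𝓝 ((B x₀ - A x₀ * P x₀) * Z lam)) := by
    have hB : Continuous B := by fun_prop
    exact ((hB.continuousAt.sub (hA.continuousAt.mul hP.continuousAt)).mul
      continuousAt_const).tendsto.mono_left nhdsWithin_le_nhds
  have hM : Filter.Tendsto
      (fun x => ∑ j ∈ univ.erase i, Mcoef η μ x lam j * Z (update lam j x)) (𝓝[≠] x₀)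
      (𝓝 (∑ j ∈ univ.erase i, Mcoef η μ x₀ lam j * Z (update lam j x₀))) := by
    refine tendsto_finsetSum _ fun j hj => ?_
    have hz : Continuous fun x => Z (update lam j x) :=
      hZhol.continuous.comp (continuous_const.update j continuous_id)
    have hm : ContinuousAt (fun x => Mcoef η μ x lam j) x₀ := by
      unfold Mcoef
      have := hb j hj
      fun_prop (disch := assumption)
    exact (hm.mul hz.continuousAt).tendsto.mono_left nhdsWithin_le_nhds
  have hlim := (hBA.add (hslope.const_mul η)).add hM
  have hzero := tendsto_nhds_unique (hlim.congr' (f₂ := fun _ => 0) ?_) tendsto_const_nhds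
  · have hMω : ∑ j ∈ univ.erase i, Mcoef η μ x₀ lam j * Z (update lam j x₀) =
        (A x₀ * P x₀) * ∑ j ∈ univ.erase i, omegaKZE η μ lam i j * Z (update lam j x₀) := by
      rw [mul_sum]
      refine sum_congr rfl fun j hj => ?_
      rw [hx₀, Mcoef_eq_mul_omegaKZE hg (mem_erase.1 hj).1, mul_assoc]
    have hBP : (∏ k, (x₀ - μ k) / (x₀ - μ k + η)) *
        ∏ k ∈ univ.erase i, (lam k - x₀) / (lam k - x₀ + η) = B x₀ / (A x₀ * P x₀) := by
      simp only [hAdef, hPdef, hBdef, prod_div_distrib]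
      field_simp
    have hs1 : ∑ k, η / (x₀ - μ k + η) = η * ∑ k, 1 / (x₀ - μ k + η) := by
      simp only [mul_sum, mul_one_div]
    have hs2 : ∑ k ∈ univ.erase i, η ^ 2 / ((lam k - x₀) * (lam k - x₀ + η)) =
        η * ∑ k ∈ univ.erase i, η / ((lam k - x₀) * (lam k - x₀ + η)) := by
      simp only [mul_sum, mul_div_assoc', sq]
    rw [hMω] at hzero
    unfold hKZE
    rw [← hx₀, hBP, hs1, hs2]
    refine mul_left_cancel₀ (mul_ne_zero hA0 hP0) ?_
    have hq := div_mul_cancel₀ (B x₀) (mul_ne_zero hA0 hP0)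
    linear_combination -hzero - Z lam * hq
  · filter_upwards [hFZ lam hg i, self_mem_nhdsWithin] with x hx hne
    have hne : x - x₀ ≠ 0 := sub_ne_zero.2 hne
    have hne' : x₀ - x ≠ 0 := by rwa [← neg_sub, neg_ne_zero]
    rw [← hx]
    unfold Mzero
    rw [← add_sum_erase univ _ (mem_univ i),
      ← mul_prod_erase univ (fun j => (lam j - x + η) / (lam j - x)) (mem_univ i)]
    have hMi : Mcoef η μ x lam i = η / (x₀ - x) * A x₀ * P x₀ := rfl
    rw [hMi]
    change _ = (B x - A x * ((x₀ - x + η) / (x₀ - x) * P x)) * Z lam + _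
    simp only [slope_def_field, Pi.mul_apply, Pi.sub_apply]
    rw [hx₀, update_eq_self, ← hx₀]
    rw [← add_assoc]
    congr 1
    have h : (x - x₀)⁻¹ = -(x₀ - x)⁻¹ := by rw [← neg_sub, inv_neg]
    simp only [div_eq_mul_inv, h]
    linear_combination (A x * P x * Z lam) * (mul_inv_cancel₀ hne')
end
end

section
/- (Theorem 2, family of Knizhnik–Zamolodchikov-type PDEs.) Let Z : ℂ^L → ℂ be symmetric and holomorphic, and suppose that for every generic point λ = (λ_1,…,λ_L) ∈ ℂ^L and every n ∈ {1,…,L}, the functional equation Σ_{i=0}^L M_i^{(n)} · Z(λ_0,…,λ̂_i,…,λ_L) = 0 (where M_i^{(n)} are the coefficients of (FZ) with the variables λ_0 and λ_n interchanged, as in (FZs)) holds for all λ_0 in a punctured neighborhood of λ_i avoiding the points where the coefficients are undefined. Then for each i ∈ {1,…,L}, each n ∈ {1,…,L} with n ≠ i, and every generic λ, η · ∂Z/∂λ_i (λ) = Σ_{j=1, j≠i}^L ω^{(n)}_{ij}(λ) · Z(λ_1,…,λ_{j−1}, λ_i, λ_{j+1},…,λ_L) + h^{(n)}_i(λ) ·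 Z(λ), where for j ≠ n: ω^{(n)}_{ij} := (a(λ_i − λ_j)/b(λ_j − λ_i)) · (a(λ_n − λ_i)/a(λ_n − λ_j)) · ∏_{k=1}^L a(λ_j − μ_k)/a(λ_i − μ_k) · ∏_{k≠i} b(λ_k − λ_i)/a(λ_k − λ_i) · ∏_{k≠j} a(λ_k − λ_j)/b(λ_k − λ_j); for j = n: ω^{(n)}_{in} := η^{−1} · ∏_{k=1}^L a(λ_i − μ_k)^{−1} · ∏_{k≠i,n} b(λ_k − λ_i)/a(λ_k − λ_i) · [ b(λ_n − λ_i) · ∏_{k=1}^L b(λ_n − μ_k) + (a(λ_i − λ_n)^2/b(λ_i − λ_n)) · ∏_{k=1}^L a(λ_n − μ_k) · ∏_{k≠i,n} a(λ_k − λ_n)/b(λ_k − λ_n) ]; and h^{(n)}_i := Σ_{j≠i,n} η^2/( b(λ_j − λ_i) · a(λ_j − λ_i) ) + Σ_{j=1}^L η/a(λ_i − μ_j) − a(λ_i − λ_n)/b(λ_i − λ_n) − 1. -/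
open Finset Function Topology

noncomputable section

/-- The functional equation (FZs) with label `n`: the coefficients of (FZ) with the variables
`λ₀` and `λ_n` interchanged, i.e. evaluated at `λ₀' = λ_n`, `λ' = update λ n λ₀`;
`M₀⁽ⁿ⁾ = M_n|_{λ₀↔λ_n}` multiplies `Z(X₀)`, `M_n⁽ⁿ⁾ = M₀|_{λ₀↔λ_n}` multiplies `Z(X_n)`,
and `M_i⁽ⁿ⁾ = M_i|_{λ₀↔λ_n}` multiplies `Z(X_i)` for `i ≠ 0, n`. -/
def FZn {L : ℕ} (Z : (Fin L → ℂ) → ℂ) (η : ℂ) (μ : Fin L → ℂ) (n : Fin L)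
    (lam0 : ℂ) (lam : Fin L → ℂ) : Prop :=
  Mcoef η μ (lam n) (Function.update lam n lam0) n * Z lam +
    Mzero η μ (lam n) (Function.update lam n lam0) * Z (Function.update lam n lam0) +
    ∑ i ∈ univ.erase n,
      Mcoef η μ (lam n) (Function.update lam n lam0) i * Z (Function.update lam i lam0) = 0

/-- The coefficient `ω^{(n)}_{ij}` of the family (KZF) of Knizhnik–Zamolodchikov-type
equations (for `n ≠ i`, `j ≠ i`); the case `j = n` carries the special coefficient
`ω^{(n)}_{in}`. -/
def omegaFam {L : ℕ} (η : ℂ) (μ lam : Fin L → ℂ) (n i j : Fin L) : ℂ :=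
  if j = n then
    η⁻¹ * (∏ k, (lam i - μ k + η)⁻¹) *
      (∏ k ∈ univ \ {i, n}, (lam k - lam i) / (lam k - lam i + η)) *
      ((lam n - lam i) * ∏ k, (lam n - μ k) +
        (lam i - lam n + η) ^ 2 / (lam i - lam n) * (∏ k, (lam n - μ k + η)) *
          ∏ k ∈ univ \ {i, n}, (lam k - lam n + η) / (lam k - lam n))
  else
    (lam i - lam j + η) / (lam j - lam i) * ((lam n - lam i + η) / (lam n - lam j + η)) *
      (∏ k, (lam j - μ k + η) / (lam i - μ k + η)) *
      (∏ k ∈ univ.erase i, (lam k - lam i) / (lam k - lam i + η)) *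
      ∏ k ∈ univ.erase j, (lam k - lam j + η) / (lam k - lam j)

/-- The coefficient `h^{(n)}_i` of the family (KZF), for `n ≠ i`. -/
def hFam {L : ℕ} (η : ℂ) (μ lam : Fin L → ℂ) (n i : Fin L) : ℂ :=
  ∑ j ∈ univ \ {i, n}, η ^ 2 / ((lam j - lam i) * (lam j - lam i + η)) +
    ∑ j, η / (lam i - μ j + η) - (lam i - lam n + η) / (lam i - lam n) - 1

/-- The part of `M_i⁽ⁿ⁾` that does not depend on `λ₀`, as a function of the value `x` of `λ_i`. -/
def regPart {L : ℕ} (η : ℂ) (μ lam : Fin L → ℂ) (n i : Fin L) (x : ℂ) : ℂ :=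
  η / (x - lam n) * (∏ k, (x - μ k + η)) *
    ∏ k ∈ univ \ {i, n}, (lam k - x + η) / (lam k - x)

lemma erase_eq_insert_sdiff_pair {α : Type*} [Fintype α] [DecidableEq α] {i n : α} (h : n ≠ i) :
    (univ.erase i : Finset α) = insert n (univ \ {i, n}) := by
  ext k
  by_cases hk : k = n <;> simp_all

lemma prod_erase_eq_mul_prod_sdiff_pair {α M : Type*} [Fintype α] [DecidableEq α] [CommMonoid M]
    {i n : α} (h : n ≠ i) (f : α → M) :
    ∏ k ∈ univ.erase i, f k = f n * ∏ k ∈ univ \ {i, n}, f k := by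
  rw [erase_eq_insert_sdiff_pair h, prod_insert (by simp)]

lemma sum_erase_eq_add_sum_sdiff_pair {α M : Type*} [Fintype α] [DecidableEq α] [AddCommMonoid M]
    {i n : α} (h : n ≠ i) (f : α → M) :
    ∑ k ∈ univ.erase i, f k = f n + ∑ k ∈ univ \ {i, n}, f k := by
  rw [erase_eq_insert_sdiff_pair h, sum_insert (by simp)]

lemma Mcoef_update_self {L : ℕ} (η : ℂ) (μ lam : Fin L → ℂ) {n i : Fin L} (h : n ≠ i) (x : ℂ) :
    Mcoef η μ (lam n) (update lam n x) n =
      regPart η μ lam n i x * ((lam i - x + η) / (lam i - x)) := by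
  have hP : ∏ k ∈ univ \ {n, i}, (update lam n x k - x + η) / (update lam n x k - x) =
      ∏ k ∈ univ \ {i, n}, (lam k - x + η) / (lam k - x) := by
    rw [pair_comm]
    refine prod_congr rfl fun k hk ↦ ?_
    have : k ≠ n := by rintro rfl; simp at hk
    rw [update_of_ne this]
  simp only [Mcoef, regPart, update_self]
  rw [prod_erase_eq_mul_prod_sdiff_pair h.symm, hP, update_of_ne h.symm]
  ring

lemma Mcoef_update_of_ne {L : ℕ} (η : ℂ) (μ lam : Fin L → ℂ) {n j : Fin L} (h : n ≠ j) (x : ℂ) :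
    Mcoef η μ (lam n) (update lam n x) j =
      regPart η μ lam n j (lam j) * ((x - lam j + η) / (x - lam j)) := by
  have hP : ∏ k ∈ univ \ {j, n}, (update lam n x k - lam j + η) / (update lam n x k - lam j) =
      ∏ k ∈ univ \ {j, n}, (lam k - lam j + η) / (lam k - lam j) := by
    refine prod_congr rfl fun k hk ↦ ?_
    have : k ≠ n := by rintro rfl; simp at hk
    rw [update_of_ne this]
  simp only [Mcoef, regPart, update_of_ne h.symm]
  rw [prod_erase_eq_mul_prod_sdiff_pair h, hP, update_self]
  ring

lemma Mzero_update {L : ℕ} (η : ℂ) (μ lam : Fin L → ℂ) (n : Fin L) (x : ℂ) :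
    Mzero η μ (lam n) (update lam n x) =
      ∏ k, (lam n - μ k) - (∏ k, (lam n - μ k + η)) * ((x - lam n + η) / (x - lam n) *
        ∏ k ∈ univ.erase n, (lam k - lam n + η) / (lam k - lam n)) := by
  rw [Mzero, ← mul_prod_erase univ (fun j ↦ (update lam n x j - lam n + η) / _) (mem_univ n),
    update_self]
  congr 3
  refine prod_congr rfl fun k hk ↦ ?_
  rw [update_of_ne (ne_of_mem_erase hk)]

lemma hasDerivAt_prod_of_logDeriv {ι : Type*} (s : Finset ι) (f : ι → ℂ → ℂ)
    (d : ι → ℂ) (x : ℂ) (h : ∀ k ∈ s, HasDerivAt (f k) (f k x * d k) x) :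
    HasDerivAt (fun y ↦ ∏ k ∈ s, f k y) ((∏ k ∈ s, f k x) * ∑ k ∈ s, d k) x := by
  classical
  induction s using Finset.induction_on with
  | empty => simpa using hasDerivAt_const x (1 : ℂ)
  | insert a s ha ih =>
    simp only [prod_insert ha, sum_insert ha]
    refine ((h a (mem_insert_self a s)).fun_mul
      (ih fun k hk ↦ h k (mem_insert_of_mem hk))).congr_deriv ?_
    ring

section Generic

variable {L : ℕ} {η : ℂ} {μ lam : Fin L → ℂ}

lemma regPart_ne_zero (hη : η ≠ 0) (hg : Generic η μ lam) {n i : Fin L} (h : n ≠ i) :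
    regPart η μ lam n i (lam i) ≠ 0 := by
  obtain ⟨h1, h2, h3⟩ := hg
  refine mul_ne_zero (mul_ne_zero (div_ne_zero hη (sub_ne_zero.2 (h1 _ _ h.symm)))
    (prod_ne_zero_iff.2 fun k _ ↦ h3 _ _)) (prod_ne_zero_iff.2 fun k hk ↦ ?_)
  have hk : k ≠ i := by rintro rfl; simp at hk
  exact div_ne_zero (h2 _ _ hk) (sub_ne_zero.2 (h1 _ _ hk))

lemma hasDerivAt_regPart (hg : Generic η μ lam) {n i : Fin L} (h : n ≠ i) :
    HasDerivAt (regPart η μ lam n i)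
      (regPart η μ lam n i (lam i) * (-1 / (lam i - lam n) + ∑ k, 1 / (lam i - μ k + η) +
        ∑ k ∈ univ \ {i, n}, η / ((lam k - lam i) * (lam k - lam i + η)))) (lam i) := by
  obtain ⟨h1, h2, h3⟩ := hg
  have hn : lam i - lam n ≠ 0 := sub_ne_zero.2 (h1 _ _ h.symm)
  have dA : HasDerivAt (fun x ↦ η / (x - lam n))
      (η / (lam i - lam n) * (-1 / (lam i - lam n))) (lam i) := by
    refine ((hasDerivAt_const (lam i) η).fun_div
      ((hasDerivAt_id (lam i)).sub_const (lam n)) hn).congr_deriv ?_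
    simp only [id]
    field_simp
    ring
  have dB := hasDerivAt_prod_of_logDeriv univ (fun k x ↦ x - μ k + η)
    (fun k ↦ 1 / (lam i - μ k + η)) (lam i) fun k _ ↦ by
      have := h3 i k
      refine (((hasDerivAt_id (lam i)).sub_const (μ k)).add_const η).congr_deriv ?_
      field_simp
  have dC := hasDerivAt_prod_of_logDeriv (univ \ {i, n})
    (fun k x ↦ (lam k - x + η) / (lam k - x))
    (fun k ↦ η / ((lam k - lam i) * (lam k - lam i + η))) (lam i) fun k hk ↦ by
      have hk : k ≠ i := by rintro rfl; simp at hk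
      have e1 := h2 _ _ hk
      have e2 := sub_ne_zero.2 (h1 _ _ hk)
      refine ((((hasDerivAt_id (lam i)).const_sub (lam k)).add_const η).fun_div
        ((hasDerivAt_id (lam i)).const_sub (lam k)) e2).congr_deriv ?_
      simp only [id]
      field_simp
      ring
  refine ((dA.fun_mul dB).fun_mul dC).congr_deriv ?_
  simp only [regPart]
  ring

lemma prod_div_mul_prod_div_swap (hg : Generic η μ lam) (n i : Fin L) :
    (∏ k ∈ univ \ {i, n}, (lam k - lam i + η) / (lam k - lam i)) *
      ∏ k ∈ univ \ {i, n}, (lam k - lam i) / (lam k - lam i + η) = 1 := by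
  rw [← prod_mul_distrib]
  refine prod_eq_one fun k hk ↦ ?_
  have hk : k ≠ i := by rintro rfl; simp at hk
  have e1 := hg.2.1 _ _ hk
  have e2 := sub_ne_zero.2 (hg.1 _ _ hk)
  field_simp

lemma regPart_mul_hFam (hg : Generic η μ lam) {n i : Fin L} (h : n ≠ i) :
    regPart η μ lam n i (lam i) * hFam η μ lam n i =
      η * (regPart η μ lam n i (lam i) * (-1 / (lam i - lam n) + ∑ k, 1 / (lam i - μ k + η) +
        ∑ k ∈ univ \ {i, n}, η / ((lam k - lam i) * (lam k - lam i + η)))) -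
      2 * regPart η μ lam n i (lam i) := by
  have hn : lam i - lam n ≠ 0 := sub_ne_zero.2 (hg.1 _ _ h.symm)
  have e1 : ∑ k, η / (lam i - μ k + η) = η * ∑ k, 1 / (lam i - μ k + η) := by
    rw [mul_sum]
    exact sum_congr rfl fun k _ ↦ by ring
  have e2 : ∑ k ∈ univ \ {i, n}, η ^ 2 / ((lam k - lam i) * (lam k - lam i + η)) =
      η * ∑ k ∈ univ \ {i, n}, η / ((lam k - lam i) * (lam k - lam i + η)) := by
    rw [mul_sum]
    exact sum_congr rfl fun k _ ↦ by ring
  have e3 : (lam i - lam n + η) / (lam i - lam n) = 1 + η / (lam i - lam n) := by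
    field_simp
  rw [hFam, e1, e2, e3]
  ring

lemma regPart_mul_omegaFam_of_ne (hg : Generic η μ lam) {n i j : Fin L}
    (h : n ≠ i) (hj : n ≠ j) (hij : j ≠ i) :
    regPart η μ lam n i (lam i) * omegaFam η μ lam n i j =
      -(regPart η μ lam n j (lam j) * ((lam i - lam j + η) / (lam i - lam j))) := by
  have hP := prod_div_mul_prod_div_swap hg n i
  obtain ⟨h1, h2, h3⟩ := hg
  have hB : ∏ k, (lam i - μ k + η) ≠ 0 := prod_ne_zero_iff.2 fun k _ ↦ h3 _ _
  have n1 := sub_ne_zero.2 (h1 _ _ h)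
  have n2 := sub_ne_zero.2 (h1 _ _ hj)
  have n3 := sub_ne_zero.2 (h1 _ _ hij)
  have n4 := h2 _ _ h
  have n5 := h2 _ _ hj
  rw [omegaFam, if_neg hj.symm, prod_erase_eq_mul_prod_sdiff_pair h,
    prod_erase_eq_mul_prod_sdiff_pair hj, prod_div_distrib]
  simp only [regPart]
  generalize ∏ k ∈ univ \ {i, n}, (lam k - lam i + η) / (lam k - lam i) = P at *
  generalize ∏ k ∈ univ \ {i, n}, (lam k - lam i) / (lam k - lam i + η) = P' at *
  generalize ∏ k ∈ univ \ {j, n}, (lam k - lam j + η) / (lam k - lam j) = Q at *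
  generalize ∏ k, (lam i - μ k + η) = B at *
  generalize ∏ k, (lam j - μ k + η) = C at *
  have hr : η / (lam i - lam n) * ((lam i - lam j + η) / (lam j - lam i)) *
      ((lam n - lam i + η) / (lam n - lam j + η)) *
      ((lam n - lam i) / (lam n - lam i + η)) * ((lam n - lam j + η) / (lam n - lam j)) =
      -(η / (lam j - lam n) * ((lam i - lam j + η) / (lam i - lam j))) := by
    rw [← neg_sub (lam n) (lam i), ← neg_sub (lam n) (lam j), ← neg_sub (lam j) (lam i)]
    field_simp
  have hBB : B * (C / B) = C := by field_simp
  linear_combination (P * P' * B * (C / B) * Q) * hr -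
    η / (lam j - lam n) * ((lam i - lam j + η) / (lam i - lam j)) * Q *
      (B * (C / B) * hP + hBB)

lemma regPart_mul_omegaFam_self (hη : η ≠ 0) (hg : Generic η μ lam) {n i : Fin L} (h : n ≠ i) :
    regPart η μ lam n i (lam i) * omegaFam η μ lam n i n =
      -Mzero η μ (lam n) (update lam n (lam i)) := by
  have hP := prod_div_mul_prod_div_swap hg n i
  obtain ⟨h1, h2, h3⟩ := hg
  have hB : ∏ k, (lam i - μ k + η) ≠ 0 := prod_ne_zero_iff.2 fun k _ ↦ h3 _ _
  have n1' := sub_ne_zero.2 (h1 _ _ h.symm)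
  rw [Mzero_update, omegaFam, if_pos rfl, prod_erase_eq_mul_prod_sdiff_pair h.symm,
    pair_comm n i, prod_inv_distrib]
  simp only [regPart]
  generalize ∏ k ∈ univ \ {i, n}, (lam k - lam i + η) / (lam k - lam i) = P at *
  generalize ∏ k ∈ univ \ {i, n}, (lam k - lam i) / (lam k - lam i + η) = P' at *
  generalize ∏ k ∈ univ \ {i, n}, (lam k - lam n + η) / (lam k - lam n) = Q at *
  generalize ∏ k, (lam i - μ k + η) = B at *
  generalize ∏ k, (lam n - μ k + η) = C at *
  generalize ∏ k, (lam n - μ k) = D at *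
  rw [← neg_sub (lam i) (lam n)]
  generalize lam i - lam n = y at *
  have hr : η / y * B * P * (η⁻¹ * B⁻¹ * P' * (-y * D + (y + η) ^ 2 / y * C * Q)) =
      (P * P') * (-D + (y + η) ^ 2 / y ^ 2 * C * Q) := by
    field_simp
  rw [hr, hP]
  ring

/-- The singular terms of (FZs) at `λ₀ = λ_i`, multiplied by `λ₀ - λ_i`, form a differentiable
function whose derivative at `λ_i` is minus the limit of the remaining terms. -/
lemma regPart_mul_fderiv_eq {Z : (Fin L → ℂ) → ℂ} (hZ : Differentiable ℂ Z)
    (hg : Generic η μ lam) {n i : Fin L} (h : n ≠ i)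
    (hFZ : ∀ᶠ x in 𝓝[≠] (lam i), FZn Z η μ n x lam) :
    regPart η μ lam n i (lam i) * (η * fderiv ℂ Z lam (Pi.single i 1)) =
      regPart η μ lam n i (lam i) * hFam η μ lam n i * Z lam -
        Mzero η μ (lam n) (update lam n (lam i)) * Z (update lam n (lam i)) -
        ∑ j ∈ univ \ {i, n}, regPart η μ lam n j (lam j) *
          ((lam i - lam j + η) / (lam i - lam j)) * Z (update lam j (lam i)) := by
  have hZc : Continuous Z := hZ.continuous
  set R : ℂ → ℂ := fun x ↦ Mzero η μ (lam n) (update lam n x) * Z (update lam n x) +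
    ∑ j ∈ univ \ {i, n}, regPart η μ lam n j (lam j) *
      ((x - lam j + η) / (x - lam j)) * Z (update lam j x) with hR
  set F : ℂ → ℂ := fun x ↦ (x - lam i - η) * regPart η μ lam n i x * Z lam +
    (x - lam i + η) * regPart η μ lam n i (lam i) * Z (update lam i x) with hF
  have hRc : ContinuousAt R (lam i) := by
    have hupd (j : Fin L) : ContinuousAt (fun x ↦ Z (update lam j x)) (lam i) :=
      (hZc.comp (continuous_const.update j continuous_id)).continuousAt
    have hfrac (j : Fin L) (hj : j ≠ i) :
        ContinuousAt (fun x ↦ (x - lam j + η) / (x - lam j)) (lam i) := by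
      refine ContinuousAt.div (by fun_prop) (by fun_prop) (sub_ne_zero.2 (hg.1 _ _ hj.symm))
    refine ContinuousAt.add (ContinuousAt.mul ?_ (hupd n)) ?_
    · simp only [Mzero_update]
      exact continuousAt_const.sub (continuousAt_const.mul ((hfrac n h).mul continuousAt_const))
    · refine tendsto_finsetSum _ fun j hj ↦ ?_
      have hj : j ≠ i := by rintro rfl; simp at hj
      exact (continuousAt_const.mul (hfrac j hj)).mul (hupd j)
  have dZ : HasDerivAt (fun x ↦ Z (update lam i x)) (fderiv ℂ Z lam (Pi.single i 1)) (lam i) := by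
    have hfd : HasFDerivAt Z (fderiv ℂ Z lam) (update lam i (lam i)) := by
      rw [update_eq_self]
      exact (hZ lam).hasFDerivAt
    exact hfd.comp_hasDerivAt (lam i) (hasDerivAt_update lam i (lam i))
  have dA := hasDerivAt_regPart hg h
  have hh := regPart_mul_hFam hg h
  set A' := regPart η μ lam n i (lam i) * (-1 / (lam i - lam n) + ∑ k, 1 / (lam i - μ k + η) +
        ∑ k ∈ univ \ {i, n}, η / ((lam k - lam i) * (lam k - lam i + η)))
  have dF : HasDerivAt F (2 * regPart η μ lam n i (lam i) * Z lam - η * A' * Z lam +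
      η * regPart η μ lam n i (lam i) * fderiv ℂ Z lam (Pi.single i 1)) (lam i) := by
    have d1 : HasDerivAt (fun x ↦ x - lam i - η) 1 (lam i) :=
      ((hasDerivAt_id (lam i)).sub_const (lam i)).sub_const η
    have d2 : HasDerivAt (fun x ↦ x - lam i + η) 1 (lam i) :=
      ((hasDerivAt_id (lam i)).sub_const (lam i)).add_const η
    refine (((d1.fun_mul dA).mul_const (Z lam)).fun_add
      ((d2.mul_const (regPart η μ lam n i (lam i))).fun_mul dZ)).congr_deriv ?_
    rw [update_eq_self]
    ring
  have hslope : ∀ᶠ x in 𝓝[≠] (lam i), slope F (lam i) x = -R x := by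
    filter_upwards [hFZ, self_mem_nhdsWithin] with x hx hxi
    have e1 : x - lam i ≠ 0 := sub_ne_zero.2 hxi
    rw [FZn, Mcoef_update_self η μ lam h, sum_erase_eq_add_sum_sdiff_pair h.symm,
      Mcoef_update_of_ne η μ lam h, pair_comm n i] at hx
    have hs : ∑ j ∈ univ \ {i, n}, Mcoef η μ (lam n) (update lam n x) j * Z (update lam j x) =
        ∑ j ∈ univ \ {i, n}, regPart η μ lam n j (lam j) *
          ((x - lam j + η) / (x - lam j)) * Z (update lam j x) := by
      refine sum_congr rfl fun j hj ↦ ?_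
      have hj : n ≠ j := by rintro rfl; simp at hj
      rw [Mcoef_update_of_ne η μ lam hj]
    rw [hs] at hx
    have hFi : F (lam i) = 0 := by
      simp only [hF, update_eq_self]
      ring
    have e3 : (lam i - x + η) / (lam i - x) = (x - lam i - η) / (x - lam i) := by
      rw [← neg_sub x (lam i)]
      field_simp
      ring
    rw [slope_def_field, hFi, sub_zero, eq_neg_iff_add_eq_zero, ← hx, e3]
    simp only [hF, hR]
    ring
  have hlim := tendsto_nhds_unique ((hasDerivAt_iff_tendsto_slope.1 dF).congr' hslope)
    (hRc.neg.tendsto.mono_left nhdsWithin_le_nhds)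
  simp only [hR, Pi.neg_apply] at hlim
  linear_combination hlim - Z lam * hh

end Generic

/-- Theorem 2: if the symmetric holomorphic function `Z` satisfies each of the
functional equations (FZs) for all `λ₀` in a punctured neighborhood of `λ_i` at every generic
`λ`, then it satisfies the family of Knizhnik–Zamolodchikov-type systems
`η ∂_i Z = Σ_{j≠i} ω^{(n)}_{ij} Z(λ with λ_j ↦ λ_i) + h^{(n)}_i Z(λ)` for every `n ≠ i`,
at every generic `λ`. -/
theorem KZF_of_FZs {L : ℕ} (hL : 2 ≤ L) (η : ℂ) (hη : η ≠ 0) (μ : Fin L → ℂ)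
    (Z : (Fin L → ℂ) → ℂ) (hZsymm : SymmFun Z) (hZhol : Differentiable ℂ Z)
    (hFZs : ∀ lam : Fin L → ℂ, Generic η μ lam → ∀ n i : Fin L,
      ∀ᶠ lam0 in 𝓝[≠] (lam i), FZn Z η μ n lam0 lam) :
    ∀ lam : Fin L → ℂ, Generic η μ lam → ∀ i n : Fin L, n ≠ i →
      η * fderiv ℂ Z lam (Pi.single i 1) =
        ∑ j ∈ univ.erase i, omegaFam η μ lam n i j * Z (Function.update lam j (lam i)) +
          hFam η μ lam n i * Z lam := by
  intro lam hg i n h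
  refine mul_left_cancel₀ (regPart_ne_zero hη hg h) ?_
  rw [regPart_mul_fderiv_eq hZhol hg h (hFZs lam hg n i), sum_erase_eq_add_sum_sdiff_pair h,
    mul_add, mul_add, mul_sum, ← mul_assoc, regPart_mul_omegaFam_self hη hg h]
  have hs : ∑ j ∈ univ \ {i, n}, regPart η μ lam n i (lam i) *
        (omegaFam η μ lam n i j * Z (update lam j (lam i))) =
      -∑ j ∈ univ \ {i, n}, regPart η μ lam n j (lam j) *
        ((lam i - lam j + η) / (lam i - lam j)) * Z (update lam j (lam i)) := by
    rw [← sum_neg_distrib]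
    refine sum_congr rfl fun j hj ↦ ?_
    simp only [mem_sdiff, mem_univ, mem_insert, mem_singleton, not_or, true_and] at hj
    rw [← mul_assoc, regPart_mul_omegaFam_of_ne hg h (Ne.symm hj.2) hj.1]
    ring
  rw [hs]
  ring
end
end

section
/- (Theorem 3.) Fix i ∈ {1,…,L} and a generic point λ ∈ ℂ^L with det(W_i) ≠ 0. Let Z : ℂ^L → ℂ be differentiable at λ and suppose that for every n ∈ {1,…,L} (including n = i, with the conventions ω^{(i)}_{ij} := ω_{ij} and h^{(i)}_i := h_i) the equation η · ∂Z/∂λ_i(λ) = Σ_{j=1, j≠i}^L ω^{(n)}_{ij}(λ) · Z(λ[λ_j := λ_i]) + h^{(n)}_i(λ) · Z(λ) holds, where λ[λ_j := λ_i] denotes λ with its j-th entry replaced by λ_i. Then det(K_i) · ∂Z/∂λ_i(λ) = det(K̄_i) · Z(λ); in particular, if det(K_i) ≠ 0 then ∂Z/∂λ_i(λ) = ( det(K̄_i)/det(K_i) ) · Z(λ). -/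
open Finset Function

noncomputable section

/-- `ω^{(n)}_{ij}` with the convention `ω^{(i)}_{ij} := ω_{ij}`. -/
def Omega {L : ℕ} (η : ℂ) (μ lam : Fin L → ℂ) (n i j : Fin L) : ℂ :=
  if n = i then omegaKZE η μ lam i j else omegaFam η μ lam n i j

/-- `h^{(n)}_i` with the convention `h^{(i)}_i := h_i`. -/
def Hcoef {L : ℕ} (η : ℂ) (μ lam : Fin L → ℂ) (n i : Fin L) : ℂ :=
  if n = i then hKZE η μ lam i else hFam η μ lam n i

/-- The `(L-1) × (L-1)` matrix `W_i`, rows `n ≠ i`, columns `j ≠ i`, entries `ω^{(n)}_{ij}`. -/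
def Wmat {L : ℕ} (η : ℂ) (μ lam : Fin L → ℂ) (i : Fin L) :
    Matrix {n : Fin L // n ≠ i} {j : Fin L // j ≠ i} ℂ :=
  fun n j => omegaFam η μ lam (n : Fin L) i (j : Fin L)

/-- The `L × L` matrix `K_i`: entry `(n, j)` is `ω^{(n)}_{ij}` for `j ≠ i` and the column
`i` is constant equal to `η` (`= c`). -/
def Kmat {L : ℕ} (η : ℂ) (μ lam : Fin L → ℂ) (i : Fin L) : Matrix (Fin L) (Fin L) ℂ :=
  fun n j => if j = i then η else Omega η μ lam n i j

/-- The `L × L` matrix `K̄_i`: as `K_i` but with column `i` entries `h^{(n)}_i`. -/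
def Kbar {L : ℕ} (η : ℂ) (μ lam : Fin L → ℂ) (i : Fin L) : Matrix (Fin L) (Fin L) ℂ :=
  fun n j => if j = i then Hcoef η μ lam n i else Omega η μ lam n i j

/-- Theorem 3: if `det W_i ≠ 0` and `Z`, differentiable at the generic point
`λ`, satisfies `η ∂_i Z = Σ_{j≠i} ω^{(n)}_{ij} Z(λ[λ_j := λ_i]) + h^{(n)}_i Z` for every
`n ∈ {1,…,L}` (with the conventions `ω^{(i)}_{ij} := ω_{ij}`, `h^{(i)}_i := h_i`), then
`det K_i · ∂_i Z = det K̄_i · Z`; in particular `∂_i Z = (det K̄_i / det K_i) Z` when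
`det K_i ≠ 0`. -/
theorem theorem_three {L : ℕ} (hL : 2 ≤ L) (η : ℂ) (hη : η ≠ 0) (μ : Fin L → ℂ)
    (lam : Fin L → ℂ) (hgen : Generic η μ lam) (i : Fin L)
    (hW : (Wmat η μ lam i).det ≠ 0)
    (Z : (Fin L → ℂ) → ℂ) (hZ : DifferentiableAt ℂ Z lam)
    (hsys : ∀ n : Fin L,
      η * fderiv ℂ Z lam (Pi.single i 1) =
        ∑ j ∈ univ.erase i, Omega η μ lam n i j * Z (Function.update lam j (lam i)) +
          Hcoef η μ lam n i * Z lam) :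
    (Kmat η μ lam i).det * fderiv ℂ Z lam (Pi.single i 1) =
        (Kbar η μ lam i).det * Z lam ∧
      ((Kmat η μ lam i).det ≠ 0 →
        fderiv ℂ Z lam (Pi.single i 1) =
          (Kbar η μ lam i).det / (Kmat η μ lam i).det * Z lam) := by
  have hK : (Kmat η μ lam i).updateCol i
      (fderiv ℂ Z lam (Pi.single i 1) • fun _ => η) =
      (Kbar η μ lam i).updateCol i
        (fun n => ∑ j, (if j = i then Z lam else Z (Function.update lam j (lam i))) •
          Kbar η μ lam i n j) := by
    ext n j
    by_cases hj : j = i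
    · subst hj
      have hsum : ∑ k ∈ univ.erase j,
          (if k = j then Z lam else Z (Function.update lam k (lam j))) * Kbar η μ lam j n k =
          ∑ k ∈ univ.erase j, Omega η μ lam n j k * Z (Function.update lam k (lam j)) := by
        refine Finset.sum_congr rfl fun k hk => ?_
        simp [Kbar, Finset.ne_of_mem_erase hk, mul_comm]
      simp only [Matrix.updateCol_self, Pi.smul_apply, smul_eq_mul]
      rw [← Finset.sum_erase_add _ _ (Finset.mem_univ j), hsum, mul_comm, hsys n]
      simp [Kbar, mul_comm]
    · simp [hj, Kmat, Kbar]
  have hKself : (Kmat η μ lam i).updateCol i (fun _ => η) = Kmat η μ lam i := by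
    ext n j
    by_cases hj : j = i <;> simp [hj, Kmat]
  have hdet : (Kmat η μ lam i).det * fderiv ℂ Z lam (Pi.single i 1) =
      (Kbar η μ lam i).det * Z lam := by
    have h := congrArg Matrix.det hK
    rw [Matrix.det_updateCol_smul, hKself, Matrix.det_updateCol_sum] at h
    simpa [mul_comm] using h
  refine ⟨hdet, fun hne => ?_⟩
  rw [div_mul_eq_mul_div, eq_div_iff hne, mul_comm, hdet]
end
end
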